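/- Let t_1,…,t_M ∈ [0,1)^d give points z_j = e^{2πi t_j} on 𝕋^d whose separation distance sep(Ω) = min_{r∈ℤ^d, j≠ℓ} ‖t_j − t_ℓ + r‖_∞ exceeds q > 0, and assume n ≥ 2d/q. If y ∈ 𝕋^d has ‖s − t_j + r‖_∞ ≥ 2d/n for all j and r ∈ ℤ^d (where y = e^{2πi s}), then the augmented Vandermonde matrix with rows (e^{2πi k t_j})_{k∈I_n}, j = 1,…,M, and (e^{2πi k s})_{k∈I_n} has rank M+1. -/

import Mathlib

open Real

noncomputable def eE (k : ℤ) (x : ℝ) : ℂ := Complex.exp (2 * π * Complex.I * (k * x))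

lemma eE_add (k : ℤ) (x y : ℝ) : eE k (x + y) = eE k x * eE k y := by
  unfold eE; rw [← Complex.exp_add]; congr 1; push_cast; ring

lemma eE_add_left (k l : ℤ) (x : ℝ) : eE (k + l) x = eE k x * eE l x := by
  unfold eE; rw [← Complex.exp_add]; congr 1; push_cast; ring

lemma eE_zero (k : ℤ) : eE k 0 = 1 := by simp [eE]

lemma eE_int (k m : ℤ) : eE k m = 1 := by
  unfold eE
  rw [Complex.exp_eq_one_iff]
  exact ⟨k * m, by push_cast; ring⟩

lemma eE_conj (k : ℤ) (x : ℝ) : (starRingEnd ℂ) (eE k x) = eE k (-x) := by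
  unfold eE
  rw [← Complex.exp_conj]; congr 1
  simp [Complex.conj_ofNat]

lemma eE_norm (k : ℤ) (x : ℝ) : ‖eE k x‖ = 1 := by
  unfold eE
  rw [show (2 * π * Complex.I * (k * x) : ℂ) = ((2 * π * (k * x) : ℝ) : ℂ) * Complex.I by
    push_cast; ring]
  exact Complex.norm_exp_ofReal_mul_I _

lemma eE_cos (k : ℤ) (h : ℝ) :
    ((2 - 2 * Real.cos (2 * π * k * h) : ℝ) : ℂ) = 2 - eE k h - eE k (-h) := by
  unfold eE
  push_cast
  rw [Complex.cos]
  have h1 : (2 * π * k * h * Complex.I : ℂ) = 2 * π * Complex.I * (k * h) := by ring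
  have h2 : (-(2 * π * k * h) * Complex.I : ℂ) = 2 * π * Complex.I * (k * (-h)) := by ring
  rw [h1, h2]; ring

lemma hs_cast {f g : ℤ → ℂ} {a b : ℂ} (H : HasSum f a) (hf : ∀ k, g k = f k) (ha : b = a) :
    HasSum g b := by
  subst ha; exact (funext hf : g = f) ▸ H

lemma bern4 (x : ℝ) : bernoulliFun 4 x = x^4 - 2*x^3 + x^2 - 1/30 := by
  simp [bernoulliFun, Polynomial.bernoulli, Finset.sum_range_succ, bernoulli_one,
    bernoulli_eq_bernoulli'_of_ne_one, bernoulli'_three, bernoulli'_four, Nat.choose]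
  ring

lemma hasSum_bern {p : ℕ} (hp : 2 ≤ p) {x : ℝ} (hx : x ∈ Set.Icc (0:ℝ) 1) :
    HasSum (fun k : ℤ => 1 / (k : ℂ) ^ p * eE k x)
      (-(2 * π * Complex.I) ^ p / p.factorial * bernoulliFun p x) := by
  have := hasSum_one_div_pow_mul_fourier_mul_bernoulliFun hp hx
  convert this using 3 with k
  rw [fourier_coe_apply]
  unfold eE
  congr 1
  push_cast; ring

lemma hasSum_diff4 {p : ℕ} (hp : 2 ≤ p) (h x y0 y1 y2 y3 y4 : ℝ)
    (h0 : y0 ∈ Set.Icc (0:ℝ) 1) (h1 : y1 ∈ Set.Icc (0:ℝ) 1) (h2 : y2 ∈ Set.Icc (0:ℝ) 1)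
    (h3 : y3 ∈ Set.Icc (0:ℝ) 1) (h4 : y4 ∈ Set.Icc (0:ℝ) 1)
    (e0 : ∀ k, eE k y0 = eE k (x + -h + -h)) (e1 : ∀ k, eE k y1 = eE k (x + -h))
    (e2 : ∀ k, eE k y2 = eE k x)
    (e3 : ∀ k, eE k y3 = eE k (x + h)) (e4 : ∀ k, eE k y4 = eE k (x + h + h)) :
    HasSum (fun k : ℤ => 1 / (k : ℂ) ^ p * ((2 - 2 * Real.cos (2 * π * k * h) : ℝ) : ℂ) ^ 2
        * eE k x)
      (-(2 * π * Complex.I) ^ p / p.factorial *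
        ((bernoulliFun p y0 - 4 * bernoulliFun p y1 + 6 * bernoulliFun p y2
          - 4 * bernoulliFun p y3 + bernoulliFun p y4 : ℝ) : ℂ)) := by
  have H := ((((hasSum_bern hp h0).sub ((hasSum_bern hp h1).mul_left 4)).add
    ((hasSum_bern hp h2).mul_left 6)).sub ((hasSum_bern hp h3).mul_left 4)).add
    (hasSum_bern hp h4)
  refine hs_cast H ?_ ?_
  · intro k
    rw [eE_cos, e0, e1, e2, e3, e4]
    simp only [eE_add]
    have : eE k h * eE k (-h) = 1 := by rw [← eE_add]; simp [eE_zero]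
    generalize eE k h = a at *
    generalize eE k (-h) = b at *
    linear_combination (2 / (k : ℂ) ^ p * eE k x) * this
  · push_cast; ring

noncomputable def gc (h : ℝ) (k : ℤ) : ℝ :=
  (if k = 0 then h ^ 4 else 0) + (2 - 2 * Real.cos (2 * π * k * h)) ^ 2 / (2 * π * k) ^ 4

lemma gc_nonneg (h : ℝ) (k : ℤ) : 0 ≤ gc h k := by
  unfold gc; split_ifs <;> positivity

lemma hasSum_gc (h x y0 y1 y2 y3 y4 : ℝ)
    (h0 : y0 ∈ Set.Icc (0:ℝ) 1) (h1 : y1 ∈ Set.Icc (0:ℝ) 1) (h2 : y2 ∈ Set.Icc (0:ℝ) 1)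
    (h3 : y3 ∈ Set.Icc (0:ℝ) 1) (h4 : y4 ∈ Set.Icc (0:ℝ) 1)
    (e0 : ∀ k, eE k y0 = eE k (x + -h + -h)) (e1 : ∀ k, eE k y1 = eE k (x + -h))
    (e2 : ∀ k, eE k y2 = eE k x)
    (e3 : ∀ k, eE k y3 = eE k (x + h)) (e4 : ∀ k, eE k y4 = eE k (x + h + h)) :
    HasSum (fun k : ℤ => (gc h k : ℂ) * eE k x)
      ((h ^ 4 - 1 / 24 * (bernoulliFun 4 y0 - 4 * bernoulliFun 4 y1 + 6 * bernoulliFun 4 y2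
          - 4 * bernoulliFun 4 y3 + bernoulliFun 4 y4) : ℝ) : ℂ) ∧
    HasSum (fun k : ℤ => (k : ℂ) ^ 2 * (gc h k : ℂ) * eE k x)
      ((1 / (8 * π ^ 2) * (bernoulliFun 2 y0 - 4 * bernoulliFun 2 y1 + 6 * bernoulliFun 2 y2
          - 4 * bernoulliFun 2 y3 + bernoulliFun 2 y4) : ℝ) : ℂ) := by
  have hpi : (π : ℂ) ≠ 0 := by exact_mod_cast Real.pi_ne_zero
  have I4 : Complex.I ^ 4 = 1 := Complex.I_pow_four
  constructor
  · have A := (hasSum_diff4 (p := 4) (by norm_num) h x y0 y1 y2 y3 y4 h0 h1 h2 h3 h4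
      e0 e1 e2 e3 e4).mul_left (1 / (2 * π : ℂ) ^ 4)
    have B := (hasSum_ite_eq (0 : ℤ) ((h : ℂ) ^ 4)).add A
    refine hs_cast B ?_ ?_
    · intro k
      unfold gc
      by_cases hk : k = 0
      · subst hk; simp [eE]
      · simp only [hk, if_false]
        push_cast
        have : (k : ℂ) ≠ 0 := by exact_mod_cast hk
        field_simp
        ring
    · simp only [mul_pow, I4, Nat.factorial]
      push_cast
      field_simp
      ring
  · have A := (hasSum_diff4 (p := 2) (by norm_num) h x y0 y1 y2 y3 y4 h0 h1 h2 h3 h4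
      e0 e1 e2 e3 e4).mul_left (1 / (2 * π : ℂ) ^ 4)
    refine hs_cast A ?_ ?_
    · intro k
      unfold gc
      by_cases hk : k = 0
      · subst hk; simp
      · simp only [hk, if_false]
        push_cast
        have : (k : ℂ) ≠ 0 := by exact_mod_cast hk
        field_simp
        ring
    · simp only [mul_pow, Complex.I_sq, Nat.factorial]
      push_cast
      field_simp
      ring

lemma hasSum_far {h x : ℝ} (h0 : 0 < h) (hx : 2 * h ≤ |x - round x|) :
    HasSum (fun k : ℤ => (gc h k : ℂ) * eE k x) 0 ∧
    HasSum (fun k : ℤ => (k : ℂ) ^ 2 * (gc h k : ℂ) * eE k x) 0 := by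
  rw [abs_sub_round_eq_min, le_min_iff] at hx
  obtain ⟨ha, hb⟩ := hx
  have key : ∀ (k : ℤ) (u : ℝ), eE k (Int.fract x + u) = eE k (x + u) := by
    intro k u
    conv_rhs => rw [← Int.floor_add_fract x]
    rw [add_assoc, eE_add k (⌊x⌋ : ℝ), eE_int, one_mul]
  set y := Int.fract x
  have := hasSum_gc h x (y + (-h + -h)) (y + -h) (y + 0) (y + h) (y + (h + h))
    ⟨by linarith, by linarith⟩ ⟨by linarith, by linarith⟩ ⟨by linarith, by linarith⟩
    ⟨by linarith, by linarith⟩ ⟨by linarith, by linarith⟩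
    (fun k => by rw [key, add_assoc]) (fun k => by rw [key]) (fun k => by rw [key, add_zero])
    (fun k => by rw [key]) (fun k => by rw [key, add_assoc])
  simp only [bern4, bernoulliFun_two] at this
  constructor
  · convert this.1 using 1
    rw [← Complex.ofReal_zero]; congr 1; ring
  · convert this.2 using 1
    rw [← Complex.ofReal_zero]; congr 1; ring

lemma hasSum_gc_zero {h : ℝ} (h0 : 0 < h) (h1 : h ≤ 1 / 4) :
    HasSum (fun k : ℤ => (gc h k : ℂ)) ((2 / 3 * h ^ 3 : ℝ) : ℂ) ∧
    HasSum (fun k : ℤ => (k : ℂ) ^ 2 * (gc h k : ℂ)) ((h / (2 * π ^ 2) : ℝ) : ℂ) := by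
  have key : ∀ (k : ℤ) (u : ℝ), eE k (1 + u) = eE k u := by
    intro k u
    have := eE_int k 1
    rw [eE_add]; simp only [Int.cast_one] at this; rw [this, one_mul]
  have := hasSum_gc h 0 (1 + (-h + -h)) (1 + -h) 0 h (h + h)
    ⟨by linarith, by linarith⟩ ⟨by linarith, by linarith⟩ ⟨by linarith, by linarith⟩
    ⟨by linarith, by linarith⟩ ⟨by linarith, by linarith⟩
    (fun k => by rw [key, zero_add]) (fun k => by rw [key, zero_add]) (fun k => rfl)
    (fun k => by rw [zero_add]) (fun k => by rw [zero_add])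
  simp only [bern4, bernoulliFun_two, eE_zero, mul_one] at this
  constructor
  · convert this.1 using 1
    congr 1; ring
  · convert this.2 using 1
    congr 1; field_simp; ring

lemma tendsto_gen {h : ℝ} (h0 : 0 < h) (h1 : h ≤ 1 / 4) (x : ℝ) :
    Summable (fun k : ℤ => (gc h k : ℂ) * eE k x) ∧
    Summable (fun k : ℤ => (k : ℂ) ^ 2 * (gc h k : ℂ) * eE k x) := by
  obtain ⟨a, b⟩ := hasSum_gc_zero h0 h1
  constructor
  · refine Summable.of_norm ?_
    simpa [norm_mul, eE_norm] using a.summable.norm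
  · refine Summable.of_norm ?_
    simpa [norm_mul, eE_norm] using b.summable.norm

lemma core {ι : Type*} [Fintype ι] {d : ℕ} {R2 h : ℝ} (h0 : 0 < h) (h1 : h ≤ 1 / 4)
    (hR : d * (h / (2 * π ^ 2)) < R2 * (2 / 3 * h ^ 3))
    (p : ι → Fin d → ℝ)
    (hp : ∀ j l, j ≠ l → ∃ i, 2 * h ≤ |(p j i - p l i) - round (p j i - p l i)|)
    (c : ι → ℂ)
    (hf : ∀ k : Fin d → ℤ, (∀ i, ((k i : ℝ)) ^ 2 < R2) → ∑ j, c j * ∏ i, eE (k i) (p j i) = 0) :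
    ∀ j, c j = 0 := by
  classical
  set G : ℝ → ℂ := fun x => ∑' k : ℤ, (gc h k : ℂ) * eE k x with hG
  set K : ℝ → ℂ := fun x => ∑' k : ℤ, (k : ℂ) ^ 2 * (gc h k : ℂ) * eE k x with hK
  set GA : Finset ℤ → ℝ → ℂ := fun A x => ∑ k ∈ A, (gc h k : ℂ) * eE k x with hGA
  set KA : Finset ℤ → ℝ → ℂ := fun A x => ∑ k ∈ A, (k : ℂ) ^ 2 * (gc h k : ℂ) * eE k x with hKA
  have tG : ∀ x, Filter.Tendsto (fun A => GA A x) Filter.atTop (nhds (G x)) :=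
    fun x => (tendsto_gen h0 h1 x).1.hasSum
  have tK : ∀ x, Filter.Tendsto (fun A => KA A x) Filter.atTop (nhds (K x)) :=
    fun x => (tendsto_gen h0 h1 x).2.hasSum
  have G0 : G 0 = ((2 / 3 * h ^ 3 : ℝ) : ℂ) := by
    simp only [hG, eE_zero, mul_one]; exact (hasSum_gc_zero h0 h1).1.tsum_eq
  have K0 : K 0 = ((h / (2 * π ^ 2) : ℝ) : ℂ) := by
    simp only [hK, eE_zero, mul_one]; exact (hasSum_gc_zero h0 h1).2.tsum_eq
  -- the finite kernel and its limit
  set TA : Finset ℤ → (Fin d → ℝ) → ℂ := fun A x =>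
    R2 * ∏ i, GA A (x i) - ∑ i₀, ∏ i, (if i = i₀ then KA A (x i) else GA A (x i)) with hTA
  set T : (Fin d → ℝ) → ℂ := fun x =>
    R2 * ∏ i, G (x i) - ∑ i₀, ∏ i, (if i = i₀ then K (x i) else G (x i)) with hT
  have tT : ∀ x, Filter.Tendsto (fun A => TA A x) Filter.atTop (nhds (T x)) := by
    intro x
    refine Filter.Tendsto.sub (Filter.Tendsto.const_mul _ (tendsto_finsetProd _ fun i _ => tG _))
      (tendsto_finsetSum _ fun i₀ _ => tendsto_finsetProd _ fun i _ => ?_)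
    by_cases hi : i = i₀
    · simpa [hi] using tK (x i₀)
    · simpa [hi] using tG (x i)
  have TAeq : ∀ A x, TA A x = ∑ k ∈ Fintype.piFinset (fun _ : Fin d => A),
      ((R2 - ∑ i, (k i : ℝ) ^ 2 : ℝ) : ℂ) * ∏ i, ((gc h (k i) : ℂ) * eE (k i) (x i)) := by
    intro A x
    have e1 : ∏ i, GA A (x i) = ∑ k ∈ Fintype.piFinset (fun _ : Fin d => A),
        ∏ i, ((gc h (k i) : ℂ) * eE (k i) (x i)) := by
      simp only [hGA]
      rw [Finset.prod_univ_sum]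
    have e2 : ∀ i₀, ∏ i, (if i = i₀ then KA A (x i) else GA A (x i)) =
        ∑ k ∈ Fintype.piFinset (fun _ : Fin d => A),
          (k i₀ : ℂ) ^ 2 * ∏ i, ((gc h (k i) : ℂ) * eE (k i) (x i)) := by
      intro i₀
      have : ∀ i, (if i = i₀ then KA A (x i) else GA A (x i)) =
          ∑ a ∈ A, (if i = i₀ then (a : ℂ) ^ 2 else 1) * ((gc h a : ℂ) * eE a (x i)) := by
        intro i
        by_cases hi : i = i₀
        · simp [hi, hKA, mul_assoc]
        · simp [hi, hGA]
      simp only [this]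
      rw [Finset.prod_univ_sum]
      refine Finset.sum_congr rfl fun k _ => ?_
      rw [Finset.prod_mul_distrib]
      congr 1
      simp
    simp only [hTA]
    rw [e1, Finset.sum_congr rfl fun i₀ _ => e2 i₀, Finset.sum_comm, Finset.mul_sum,
      ← Finset.sum_sub_distrib]
    refine Finset.sum_congr rfl fun k _ => ?_
    rw [← Finset.sum_mul]; push_cast; ring
  -- the quadratic form
  set f : (Fin d → ℤ) → ℂ := fun k => ∑ j, c j * ∏ i, eE (k i) (p j i) with hfdef
  have quad : ∀ A, ∑ j, ∑ l, c j * (starRingEnd ℂ) (c l) * TA A (fun i => p j i - p l i) =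
      ((∑ k ∈ Fintype.piFinset (fun _ : Fin d => A),
        (R2 - ∑ i, (k i : ℝ) ^ 2) * (∏ i, gc h (k i)) * ‖f k‖ ^ 2 : ℝ) : ℂ) := by
    intro A
    have e1 : ∀ k, ((‖f k‖ ^ 2 : ℝ) : ℂ) = ∑ j, ∑ l, c j * (starRingEnd ℂ) (c l) *
        ∏ i, eE (k i) (p j i - p l i) := by
      intro k
      rw [Complex.ofReal_pow, ← Complex.mul_conj']
      simp only [hfdef, map_sum, map_mul, map_prod, eE_conj]
      rw [Finset.sum_mul_sum]
      refine Finset.sum_congr rfl fun j _ => Finset.sum_congr rfl fun l _ => ?_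
      simp only [sub_eq_add_neg, eE_add, Finset.prod_mul_distrib]
      ring
    rw [Complex.ofReal_sum]
    have e2 : ∀ k : Fin d → ℤ,
        (((R2 - ∑ i, (k i : ℝ) ^ 2) * (∏ i, gc h (k i)) * ‖f k‖ ^ 2 : ℝ) : ℂ) =
        ∑ j, ∑ l, c j * (starRingEnd ℂ) (c l) * (((R2 - ∑ i, (k i : ℝ) ^ 2 : ℝ) : ℂ) *
          ∏ i, ((gc h (k i) : ℂ) * eE (k i) (p j i - p l i))) := by
      intro k
      rw [Complex.ofReal_mul, e1, Finset.mul_sum]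
      refine Finset.sum_congr rfl fun j _ => ?_
      rw [Finset.mul_sum]
      refine Finset.sum_congr rfl fun l _ => ?_
      rw [Finset.prod_mul_distrib, Complex.ofReal_mul, Complex.ofReal_prod]
      ring
    simp only [e2]
    symm
    rw [Finset.sum_comm]
    refine Finset.sum_congr rfl fun j _ => ?_
    rw [Finset.sum_comm]
    refine Finset.sum_congr rfl fun l _ => ?_
    rw [TAeq, Finset.mul_sum]
  have quad_le : ∀ A, (∑ j, ∑ l, c j * (starRingEnd ℂ) (c l) *
      TA A (fun i => p j i - p l i)).re ≤ 0 := by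
    intro A
    rw [quad, Complex.ofReal_re]
    refine Finset.sum_nonpos fun k _ => ?_
    by_cases hk : ∀ i, ((k i : ℝ)) ^ 2 < R2
    · have : f k = 0 := hf k hk
      simp [this]
    · push Not at hk
      obtain ⟨i, hi⟩ := hk
      have a1 : R2 - ∑ i, (k i : ℝ) ^ 2 ≤ 0 := by
        have := Finset.single_le_sum (f := fun i => (k i : ℝ) ^ 2) (fun i _ => sq_nonneg _)
          (Finset.mem_univ i)
        linarith
      have a2 : 0 ≤ ∏ i, gc h (k i) := Finset.prod_nonneg fun i _ => gc_nonneg _ _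
      exact mul_nonpos_of_nonpos_of_nonneg (mul_nonpos_of_nonpos_of_nonneg a1 a2) (sq_nonneg _)
  have lim : Filter.Tendsto (fun A => (∑ j, ∑ l, c j * (starRingEnd ℂ) (c l) *
      TA A (fun i => p j i - p l i)).re) Filter.atTop
      (nhds (∑ j, ∑ l, c j * (starRingEnd ℂ) (c l) * T (fun i => p j i - p l i)).re) :=
    (Complex.continuous_re.tendsto _).comp
      (tendsto_finsetSum _ fun j _ => tendsto_finsetSum _ fun l _ =>
        Filter.Tendsto.const_mul _ (tT _))
  have fin := le_of_tendsto' lim quad_le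
  have Toff : ∀ j l, j ≠ l → T (fun i => p j i - p l i) = 0 := by
    intro j l hjl
    obtain ⟨i, hi⟩ := hp j l hjl
    have g0 : G (p j i - p l i) = 0 := (hasSum_far h0 hi).1.tsum_eq
    have k0 : K (p j i - p l i) = 0 := (hasSum_far h0 hi).2.tsum_eq
    simp only [hT]
    rw [Finset.prod_eq_zero (Finset.mem_univ i) g0, Finset.sum_eq_zero]
    · simp
    · intro i₀ _
      refine Finset.prod_eq_zero (Finset.mem_univ i) ?_
      split_ifs
      · exact k0
      · exact g0
  set D : ℝ := R2 * (2 / 3 * h ^ 3) ^ d -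
    d * ((h / (2 * π ^ 2)) * (2 / 3 * h ^ 3) ^ (d - 1)) with hD
  have Tdiag : ∀ j, T (fun i => p j i - p j i) = (D : ℂ) := by
    intro j
    have : ∀ i₀ : Fin d, ∏ i : Fin d, (if i = i₀ then K 0 else G 0) = K 0 * G 0 ^ (d - 1) := by
      intro i₀
      rw [← Finset.mul_prod_erase _ _ (Finset.mem_univ i₀), if_pos rfl]
      congr 1
      rw [Finset.prod_congr rfl (g := fun _ => G 0)]
      · simp
      · intro i hi
        rw [if_neg (Finset.ne_of_mem_erase hi)]
    simp only [hT, sub_self, this, hD]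
    rw [G0, K0]
    simp
  have Dpos : 0 < D := by
    have hg : 0 < 2 / 3 * h ^ 3 := by positivity
    rcases Nat.eq_zero_or_pos d with rfl | hd
    · simp only [Nat.cast_zero, zero_mul] at hR
      simp only [hD]
      simp
      exact pos_of_mul_pos_left hR hg.le
    · obtain ⟨e, rfl⟩ : ∃ e, d = e + 1 := ⟨d - 1, by omega⟩
      have := mul_lt_mul_of_pos_right hR (pow_pos hg e)
      simp only [hD, Nat.add_sub_cancel]
      rw [pow_succ _ e]
      generalize (2 / 3 * h ^ 3) ^ e = z at *
      linarith
  have eqn : (∑ j, ∑ l, c j * (starRingEnd ℂ) (c l) * T (fun i => p j i - p l i)).re =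
      (∑ j, ‖c j‖ ^ 2) * D := by
    have : ∀ j, ∑ l, c j * (starRingEnd ℂ) (c l) * T (fun i => p j i - p l i) =
        ((‖c j‖ ^ 2 * D : ℝ) : ℂ) := by
      intro j
      rw [Finset.sum_eq_single j]
      · rw [Tdiag, Complex.mul_conj']; push_cast; rfl
      · intro l _ hl
        rw [Toff j l hl.symm, mul_zero]
      · simp
    simp only [this]
    rw [← Complex.ofReal_sum, Complex.ofReal_re, Finset.sum_mul]
  rw [eqn] at fin
  have s0 : ∑ j, ‖c j‖ ^ 2 = 0 := by
    have : 0 ≤ ∑ j, ‖c j‖ ^ 2 := Finset.sum_nonneg fun _ _ => sq_nonneg _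
    nlinarith
  intro j
  have := (Finset.sum_eq_zero_iff_of_nonneg (fun j _ => sq_nonneg ‖c j‖)).1 s0 j (Finset.mem_univ j)
  simpa using this

/-- If the points `e^{2πi t_j}` on `𝕋^d` are `q`-separated, `n ≥ 2d/q`,
and `y = e^{2πi s} ∈ 𝕋^d` is at torus distance at least `2d/n` from every `t_j`, then
the augmented Vandermonde matrix (rows at `t_1, …, t_M` and `s`, columns indexed by
`I_n = {0,…,n}^d`) has rank `M + 1`. -/
theorem augmented_vandermonde_full_rank
    (d M n : ℕ) (q : ℝ) (hq : 0 < q)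
    (t : Fin M → Fin d → ℝ)
    (hsep : ∀ j l, j ≠ l → ∀ r : Fin d → ℤ, ∃ i, q < |t j i - t l i + r i|)
    (hn : 2 * d / q ≤ n)
    (s : Fin d → ℝ)
    (hs : ∀ j, ∀ r : Fin d → ℤ, ∃ i, 2 * d / n ≤ |s i - t j i + r i|)
    (B : Matrix (Option (Fin M)) (Fin d → Fin (n+1)) ℂ)
    (hB1 : ∀ j k, B (some j) k =
      ∏ i, Complex.exp (2 * π * Complex.I * t j i) ^ (k i : ℕ))
    (hB2 : ∀ k, B none k =
      ∏ i, Complex.exp (2 * π * Complex.I * s i) ^ (k i : ℕ)) :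
    B.rank = M + 1 := by
  suffices H : LinearIndependent ℂ B.row by
    rw [H.rank_matrix]; simp
  rw [Fintype.linearIndependent_iff]
  intro c hc
  have hc' : ∀ k, ∑ j, c j * B j k = 0 := by
    intro k
    have := congrFun hc k
    simpa [Finset.sum_apply, Matrix.row] using this
  rcases Nat.eq_zero_or_pos M with rfl | hM
  · have := hc' 0
    rw [Fintype.sum_option] at this
    simp [hB2] at this
    intro i
    rcases i with _ | i
    · exact this
    · exact i.elim0
  have hd : 0 < d := by
    obtain ⟨i, -⟩ := hs ⟨0, hM⟩ 0
    exact Nat.pos_of_ne_zero fun h => by subst h; exact i.elim0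
  have hdR : (1 : ℝ) ≤ d := by exact_mod_cast hd
  have hn0 : (0 : ℝ) < n := lt_of_lt_of_le (by positivity) hn
  set p : Option (Fin M) → Fin d → ℝ := fun j => j.elim s t with hpdef
  have hB : ∀ j k, B j k = ∏ i, eE (k i : ℕ) (p j i) := by
    intro j k
    have e : ∀ (a : ℕ) (x : ℝ), Complex.exp (2 * π * Complex.I * x) ^ a = eE (a : ℤ) x := by
      intro a x
      unfold eE
      rw [← Complex.exp_nat_mul]; congr 1; push_cast; ring
    rcases j with _ | j
    · rw [hB2]; simp only [e, hpdef, Option.elim]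
    · rw [hB1]; simp only [e, hpdef, Option.elim]
  set h : ℝ := d / n with hh
  have h0 : 0 < h := by positivity
  have h2 : 2 * h = 2 * d / n := by rw [hh]; ring
  have hhn : h * n = d := by rw [hh]; field_simp
  have hs' : ∀ j, ∃ i, 2 * h ≤ |(s i - t j i) - round (s i - t j i)| := by
    intro j
    obtain ⟨i, hi⟩ := hs j (fun i => - round (s i - t j i))
    refine ⟨i, ?_⟩
    rw [h2]
    simpa [← sub_eq_add_neg] using hi
  have h1 : h ≤ 1 / 4 := by
    obtain ⟨i, hi⟩ := hs' ⟨0, hM⟩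
    have := abs_sub_round (s i - t ⟨0, hM⟩ i)
    linarith
  have hq2 : 2 * h ≤ q := by
    rw [div_le_iff₀ hq] at hn
    rw [h2, div_le_iff₀ hn0]; linarith
  have hp : ∀ j l, j ≠ l → ∃ i, 2 * h ≤ |(p j i - p l i) - round (p j i - p l i)| := by
    intro j l hjl
    rcases j with _ | j <;> rcases l with _ | l
    · exact absurd rfl hjl
    · exact hs' l
    · obtain ⟨i, hi⟩ := hs j (fun i => round (t j i - s i))
      refine ⟨i, ?_⟩
      rw [h2]
      refine hi.trans (le_of_eq ?_)
      rw [← abs_neg]; simp only [hpdef, Option.elim]; congr 1; ring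
    · obtain ⟨i, hi⟩ := hsep j l (fun h => hjl (by rw [h])) (fun i => - round (t j i - t l i))
      refine ⟨i, hq2.trans (hi.le.trans (le_of_eq ?_))⟩
      simp only [hpdef, Option.elim]; congr 1; push_cast; ring
  -- modulation
  set m : ℤ := (n : ℤ) / 2 with hm
  have fin := core (R2 := (n : ℝ) ^ 2 / 4) h0 h1 ?_ p hp (fun j => c j * ∏ i, eE m (p j i)) ?_
  · intro j
    have := fin j
    rcases mul_eq_zero.1 this with h | h
    · exact h
    · rw [Finset.prod_eq_zero_iff] at h
      obtain ⟨i, -, hi⟩ := h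
      have hno := eE_norm m (p j i)
      rw [hi, norm_zero] at hno
      exact absurd hno zero_ne_one
  · have hpi := Real.pi_gt_three
    have e : (n : ℝ) ^ 2 / 4 * (2 / 3 * h ^ 3) = (d : ℝ) * d * h / 6 := by
      rw [← hhn]; ring
    rw [e]
    have h9 : 9 < π ^ 2 := by nlinarith
    have : h / (2 * π ^ 2) < h / 6 := by
      apply div_lt_div_of_pos_left h0 (by norm_num); linarith
    have h3 : (d : ℝ) * (h / (2 * π ^ 2)) < d * (h / 6) :=
      mul_lt_mul_of_pos_left this (by linarith)
    have h4 : (d : ℝ) * (h / 6) ≤ d * (d * (h / 6)) :=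
      mul_le_mul_of_nonneg_left (le_mul_of_one_le_left (by positivity) hdR) (by linarith)
    calc _ < _ := h3
      _ ≤ _ := h4
      _ = _ := by ring
  · intro k hk
    have hk' : ∀ i, 0 ≤ k i + m ∧ k i + m ≤ n := by
      intro i
      have h4 : (2 * k i) ^ 2 < (n : ℤ) ^ 2 := by
        have : (2 * (k i : ℝ)) ^ 2 < (n : ℝ) ^ 2 := by have := hk i; nlinarith
        exact_mod_cast this
      have := abs_lt_of_sq_lt_sq h4 (by positivity)
      rw [abs_lt] at this
      omega
    have := hc' (fun i => ⟨(k i + m).toNat, by have := hk' i; omega⟩)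
    rw [← this]
    refine Finset.sum_congr rfl fun j _ => ?_
    rw [hB, mul_assoc, ← Finset.prod_mul_distrib]
    congr 1
    refine Finset.prod_congr rfl fun i _ => ?_
    rw [← eE_add_left]
    congr 1
    have := hk' i
    simp only
    omega
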